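/- Let α ∈ (1,2), σ = 1 - α/2, τ > 0, and let k ≥ 1 be an integer. Then 4σ c₀^{(k,α)} − (1 + 2σ) c₁^{(k,α)} > 0. -/

import Mathlib

open MeasureTheory Finset

/-- `a_l^{(k,α)}` from the H3N3-2σ construction. -/
noncomputable def aCoef (α σ τ : ℝ) (k l : ℕ) : ℝ :=
  if l = 1 then
    (3/2) * τ ^ (2 - α) * ∫ s in (0:ℝ)..(1/2), (s - 1/3) * ((k : ℝ) + σ - s) ^ (1 - α)
  else
    τ ^ (2 - α) * ∫ s in (0:ℝ)..1, (s - 1/2) * ((k : ℝ) + σ - (l : ℝ) + 3/2 - s) ^ (1 - α)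

/-- `b_l^{(k,α)}` from the H3N3-2σ construction. -/
noncomputable def bCoef (α σ τ : ℝ) (k l : ℕ) : ℝ :=
  if l = k then
    τ ^ (2 - α) * ∫ s in (0:ℝ)..(σ + 1/2), s ^ (1 - α)
  else
    τ ^ (2 - α) * ∫ s in (0:ℝ)..1, (3/2 - s) * ((k : ℝ) + σ - (l : ℝ) + 1/2 - s) ^ (1 - α)

/-- `c_l^{(k,α)}`, the H3N3-2σ coefficients. -/
noncomputable def cCoef (α σ τ : ℝ) (k l : ℕ) : ℝ :=
  if l = k then
    (3/2) * τ ^ (2 - α) * ∫ s in (0:ℝ)..(1/2), (1 - s) * ((k : ℝ) + σ - s) ^ (1 - α)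
  else
    aCoef α σ τ k (k - l) + bCoef α σ τ k (k - l)

/-- A Chebyshev-type inequality: weighting a monotone function by `s - c`. -/
theorem mul_integral_sub_le_integral_sub_mul {a b c : ℝ} {g : ℝ → ℝ} (hab : a ≤ b)
    (hc : c ∈ Set.Icc a b) (hg : ContinuousOn g (Set.Icc a b)) (hm : MonotoneOn g (Set.Icc a b)) :
    g c * ∫ s in a..b, (s - c) ≤ ∫ s in a..b, (s - c) * g s := by
  rw [← intervalIntegral.integral_const_mul]
  refine intervalIntegral.integral_mono_on hab (Continuous.intervalIntegrable (by fun_prop) _ _)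
    (ContinuousOn.intervalIntegrable_of_Icc hab (by fun_prop)) fun s hs => ?_
  rcases le_total s c with h | h
  · nlinarith [hm hs hc h]
  · nlinarith [hm hc hs h]

theorem continuousOn_sub_rpow {a b x : ℝ} (p : ℝ) (hx : b < x) :
    ContinuousOn (fun s : ℝ => (x - s) ^ p) (Set.Icc a b) :=
  ContinuousOn.rpow_const (by fun_prop) fun s hs => Or.inl (by linarith [hs.2])

theorem monotoneOn_sub_rpow {a b x p : ℝ} (hp : p ≤ 0) (hx : b < x) :
    MonotoneOn (fun s : ℝ => (x - s) ^ p) (Set.Icc a b) := fun s _ t ht hst =>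
  Real.rpow_le_rpow_of_nonpos (by linarith [ht.2]) (by linarith) hp

theorem antitoneOn_rpow_sub_rpow_add_one {p : ℝ} (hp : p ≤ 0) :
    AntitoneOn (fun x : ℝ => x ^ p - (x + 1) ^ p) (Set.Ioi 0) := by
  have hd : ∀ x ∈ Set.Ioi (0 : ℝ), HasDerivAt (fun x : ℝ => x ^ p - (x + 1) ^ p)
      (1 * p * x ^ (p - 1) - 1 * p * (x + 1) ^ (p - 1)) x := fun x hx => by
    have hx : 0 < x := hx
    exact ((hasDerivAt_id x).rpow_const (Or.inl hx.ne')).sub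
      (((hasDerivAt_id x).add_const 1).rpow_const (Or.inl (by simp only [id]; positivity)))
  refine antitoneOn_of_deriv_nonpos (convex_Ioi 0)
    (fun x hx => (hd x hx).continuousAt.continuousWithinAt)
    (fun x hx => ?_) fun x hx => ?_
  · rw [interior_Ioi] at hx
    exact (hd x hx).differentiableAt.differentiableWithinAt
  · rw [interior_Ioi] at hx
    rw [(hd x hx).deriv]
    have hx : 0 < x := hx
    nlinarith [Real.rpow_le_rpow_of_nonpos hx (by linarith : x ≤ x + 1) (by linarith : p - 1 ≤ 0)]

theorem integral_sub_const (a b c : ℝ) :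
    ∫ s in a..b, (s - c) = (b ^ 2 - a ^ 2) / 2 - (b - a) * c := by
  rw [intervalIntegral.integral_sub (by simp) (by simp)]
  simp

theorem integral_sub_half_mul_rpow_nonneg {x p : ℝ} (hp : p ≤ 0) (hx : 1 < x) :
    0 ≤ ∫ s in (0:ℝ)..1, (s - 1/2) * (x - s) ^ p := by
  have h := mul_integral_sub_le_integral_sub_mul zero_le_one (c := 1/2) (by norm_num)
    (continuousOn_sub_rpow p hx) (monotoneOn_sub_rpow hp hx)
  rw [integral_sub_const] at h
  norm_num at h ⊢
  exact h

theorem integral_sub_half_mul_rpow_add_one_le {x p : ℝ} (hp : p ≤ 0) (hx : 1 < x) :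
    ∫ s in (0:ℝ)..1, (s - 1/2) * (x + 1 - s) ^ p ≤ ∫ s in (0:ℝ)..1, (s - 1/2) * (x - s) ^ p := by
  have c1 := continuousOn_sub_rpow (a := 0) p hx
  have c2 := continuousOn_sub_rpow (a := 0) p (by linarith : 1 < x + 1)
  have h := mul_integral_sub_le_integral_sub_mul zero_le_one (c := 1/2) (by norm_num) (c1.sub c2)
    fun s hs t ht hst => by
      have := antitoneOn_rpow_sub_rpow_add_one hp (a := x - t) (b := x - s)
        (by simp only [Set.mem_Ioi]; linarith [ht.2]) (by simp only [Set.mem_Ioi]; linarith [hs.2])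
        (by linarith)
      simpa only [Pi.sub_apply, sub_add_eq_add_sub] using this
  rw [integral_sub_const, show ((1:ℝ) ^ 2 - 0 ^ 2) / 2 - (1 - 0) * (1 / 2) = 0 by norm_num,
    mul_zero] at h
  simp only [Pi.sub_apply, mul_sub] at h
  rw [intervalIntegral.integral_sub
    (ContinuousOn.intervalIntegrable_of_Icc zero_le_one (by fun_prop))
    (ContinuousOn.intervalIntegrable_of_Icc zero_le_one (by fun_prop))] at h
  linarith

theorem integral_mul_rpow_add_integral_sub_half_mul_rpow_lt {x p : ℝ} (hp : p < 0) (hx : 1 < x) :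
    (∫ s in (0:ℝ)..1, (3/2 - s) * (x - s) ^ p) + ∫ s in (0:ℝ)..1, (s - 1/2) * (x - s) ^ p
      < (x - 1) ^ p := by
  have c1 := continuousOn_sub_rpow (a := 0) p hx
  rw [← intervalIntegral.integral_add
    (ContinuousOn.intervalIntegrable_of_Icc zero_le_one (by fun_prop))
    (ContinuousOn.intervalIntegrable_of_Icc zero_le_one (by fun_prop))]
  calc _ = ∫ s in (0:ℝ)..1, (x - s) ^ p := by congr 1; ext s; ring
    _ < ∫ s in (0:ℝ)..1, (x - 1) ^ p := by
      refine intervalIntegral.integral_lt_integral_of_continuousOn_of_le_of_exists_lt zero_lt_one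
        c1 continuousOn_const (fun s hs => ?_) ⟨0, by simp, ?_⟩
      · exact Real.rpow_le_rpow_of_nonpos (by linarith) (by linarith [hs.2]) hp.le
      · exact Real.rpow_lt_rpow_of_neg (by linarith) (by linarith) hp
    _ = _ := by simp

theorem rpow_sub_half_le_two_mul_rpow {x p : ℝ} (hp : p ≤ 0) (hp1 : -1 ≤ p) (hx : 1 ≤ x) :
    (x - 1/2) ^ p ≤ 2 * x ^ p :=
  calc (x - 1/2) ^ p ≤ (1/2 * x) ^ p :=
        Real.rpow_le_rpow_of_nonpos (by linarith) (by linarith) hp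
    _ = (1/2) ^ p * x ^ p := Real.mul_rpow (by norm_num) (by linarith)
    _ ≤ (1/2) ^ (-1 : ℝ) * x ^ p := by
        gcongr ?_ * _
        exact Real.rpow_le_rpow_of_exponent_ge (by norm_num) (by norm_num) hp1
    _ = 2 * x ^ p := by rw [Real.rpow_neg_one]; norm_num

theorem integral_sub_third_mul_rpow_nonpos {x p : ℝ} (hp : p ≤ 0) (hp1 : -1 ≤ p) (hx : 1 ≤ x) :
    ∫ s in (0:ℝ)..(1/2), (s - 1/3) * (x - s) ^ p ≤ 0 := by
  have h0 : (0:ℝ) ≤ 1/2 := by norm_num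
  have hx' : 1/2 < x := by linarith
  have c1 := continuousOn_sub_rpow (a := 0) p hx'
  have hm := monotoneOn_sub_rpow (a := 0) hp hx'
  have hM := rpow_sub_half_le_two_mul_rpow hp hp1 hx
  calc _ ≤ ∫ s in (0:ℝ)..(1/2), 4/3 * x ^ p * (s - 1/4) := by
        refine intervalIntegral.integral_mono_on h0
          (ContinuousOn.intervalIntegrable_of_Icc h0 (by fun_prop))
          (Continuous.intervalIntegrable (by fun_prop) _ _) fun s hs => ?_
        have l : x ^ p ≤ (x - s) ^ p := by simpa using hm (by simp) hs hs.1
        have r : (x - s) ^ p ≤ (x - 1/2) ^ p := hm hs (by simp) hs.2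
        have hxp : 0 < x ^ p := by positivity
        have := hs.1
        have := hs.2
        rcases le_total s (1/3) with h | h <;> nlinarith
    _ ≤ 0 := by
        rw [intervalIntegral.integral_const_mul, integral_sub_const]
        norm_num

theorem neg_rpow_le_integral_sub_third_mul_rpow {u p : ℝ} (hp : p ≤ 0) (hu : 0 < u) :
    -(u ^ p) / 24 ≤ ∫ s in (0:ℝ)..(1/2), (s - 1/3) * (u + 1/2 - s) ^ p := by
  have hx : 1/2 < u + 1/2 := by linarith
  have h := mul_integral_sub_le_integral_sub_mul (by norm_num) (c := 1/3) (by norm_num)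
    (continuousOn_sub_rpow (a := 0) p hx) (monotoneOn_sub_rpow hp hx)
  rw [integral_sub_const] at h
  have := Real.rpow_le_rpow_of_nonpos hu (by linarith : u ≤ u + 1/2 - 1/3) hp
  norm_num at h this ⊢
  linarith

theorem integral_one_sub_mul_rpow_le {u p : ℝ} (hp : p ≤ 0) (hu : 0 < u) :
    ∫ s in (0:ℝ)..(1/2), (1 - s) * (u + 1/2 - s) ^ p ≤ 3/8 * u ^ p := by
  have h0 : (0:ℝ) ≤ 1/2 := by norm_num
  have c1 := continuousOn_sub_rpow (a := 0) p (by linarith : 1/2 < u + 1/2)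
  calc _ ≤ ∫ s in (0:ℝ)..(1/2), -u ^ p * (s - 1) := by
        refine intervalIntegral.integral_mono_on h0
          (ContinuousOn.intervalIntegrable_of_Icc h0 (by fun_prop))
          (Continuous.intervalIntegrable (by fun_prop) _ _) fun s hs => ?_
        nlinarith [hs.2, Real.rpow_le_rpow_of_nonpos hu (by linarith [hs.2] : u ≤ u + 1/2 - s) hp]
    _ = _ := by
        rw [intervalIntegral.integral_const_mul, integral_sub_const]
        ring

/-- Lemma 2.1, inequality (2.11): `4σ c₀^{(k,α)} - (1+2σ) c₁^{(k,α)} > 0`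
with `σ = 1 - α/2`. -/
theorem cCoef_four_sigma_pos (α τ : ℝ) (hα1 : 1 < α) (hα2 : α < 2)
    (hτ : 0 < τ) (k : ℕ) (hk : 1 ≤ k) :
    0 < 4 * (1 - α/2) * cCoef α (1 - α/2) τ k 0 -
        (1 + 2 * (1 - α/2)) * cCoef α (1 - α/2) τ k 1 := by
  obtain ⟨u, rfl⟩ : ∃ u, α = 3 - 2 * u := ⟨(3 - α) / 2, by ring⟩
  have hu : 1/2 < u := by linarith
  have hT : 0 < τ ^ (2 - (3 - 2 * u)) := by positivity
  have hp : 1 - (3 - 2 * u) < 0 := by linarith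
  have hp1 : -1 < 1 - (3 - 2 * u) := by linarith
  have hb : 4 * (1 - (3 - 2 * u)/2) *
      ∫ s in (0:ℝ)..(1 - (3 - 2 * u)/2 + 1/2), s ^ (1 - (3 - 2 * u))
      = 2 * u * u ^ (1 - (3 - 2 * u)) := by
    rw [integral_rpow (Or.inl hp1), show 1 - (3 - 2 * u)/2 + 1/2 = u by ring,
      Real.zero_rpow (by linarith), Real.rpow_add_one (by linarith), mul_div_assoc',
      div_eq_iff (by linarith)]
    ring
  have hup : 0 < u ^ (1 - (3 - 2 * u)) := by positivity
  have hA := integral_sub_half_mul_rpow_nonneg hp.le (by linarith : 1 < u + 1)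
  have hAB := integral_mul_rpow_add_integral_sub_half_mul_rpow_lt hp (by linarith : 1 < u + 1)
  rw [add_sub_cancel_right] at hAB
  obtain rfl | rfl | ⟨n, rfl⟩ : k = 1 ∨ k = 2 ∨ ∃ n, k = n + 3 := by
    rcases k with _ | _ | _ | n <;> simp at *
  · have hl := neg_rpow_le_integral_sub_third_mul_rpow hp.le (by linarith : 0 < u)
    have hr := integral_one_sub_mul_rpow_le hp.le (by linarith : 0 < u)
    have e : ((1 : ℕ) : ℝ) + (1 - (3 - 2 * u)/2) = u + 1/2 := by push_cast; ring
    simp only [cCoef, aCoef, bCoef, e, zero_ne_one, if_true, if_false, Nat.sub_zero]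
    generalize (∫ s in (0:ℝ)..(1/2), (s - 1/3) * (u + 1/2 - s) ^ (1 - (3 - 2 * u))) = I at *
    generalize (∫ s in (0:ℝ)..(1/2), (1 - s) * (u + 1/2 - s) ^ (1 - (3 - 2 * u))) = J at *
    generalize (∫ s in (0:ℝ)..(1 - (3 - 2 * u)/2 + 1/2), s ^ (1 - (3 - 2 * u))) = K at *
    have : 0 < 4 * (1 - (3 - 2 * u)/2) * (3/2 * I + K) -
        (1 + 2 * (1 - (3 - 2 * u)/2)) * (3/2 * J) := by
      nlinarith
    linear_combination mul_pos hT this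
  · have hl := integral_sub_third_mul_rpow_nonpos hp.le hp1.le (by linarith : 1 ≤ u + 3/2)
    have e : ((2 : ℕ) : ℝ) + (1 - (3 - 2 * u)/2) = u + 3/2 := by push_cast; ring
    have e1 : u + 3/2 - ((2 : ℕ) : ℝ) + 3/2 = u + 1 := by push_cast; ring
    have e2 : u + 3/2 - ((1 : ℕ) : ℝ) + 1/2 = u + 1 := by push_cast; ring
    simp only [cCoef, aCoef, bCoef, e, e1, e2, OfNat.zero_ne_ofNat, OfNat.one_ne_ofNat,
      OfNat.ofNat_ne_one, if_true, if_false, Nat.sub_zero, Nat.reduceSub]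
    generalize (∫ s in (0:ℝ)..(1/2), (s - 1/3) * (u + 3/2 - s) ^ (1 - (3 - 2 * u))) = I at *
    generalize (∫ s in (0:ℝ)..1, (s - 1/2) * (u + 1 - s) ^ (1 - (3 - 2 * u))) = A at *
    generalize (∫ s in (0:ℝ)..1, (3/2 - s) * (u + 1 - s) ^ (1 - (3 - 2 * u))) = B at *
    generalize (∫ s in (0:ℝ)..(1 - (3 - 2 * u)/2 + 1/2), s ^ (1 - (3 - 2 * u))) = K at *
    have : 0 < 4 * (1 - (3 - 2 * u)/2) * (A + K) -
        (1 + 2 * (1 - (3 - 2 * u)/2)) * (3/2 * I + B) := by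
      nlinarith
    linear_combination mul_pos hT this
  · have hl := integral_sub_half_mul_rpow_add_one_le hp.le (by linarith : 1 < u + 1)
    have e0 : ((n + 3 : ℕ) : ℝ) + (1 - (3 - 2 * u)/2) - ((n + 3 : ℕ) : ℝ) + 3/2 = u + 1 := by ring
    have e1 : ((n + 3 : ℕ) : ℝ) + (1 - (3 - 2 * u)/2) - ((n + 2 : ℕ) : ℝ) + 3/2 = u + 1 + 1 := by
      push_cast; ring
    have e2 : ((n + 3 : ℕ) : ℝ) + (1 - (3 - 2 * u)/2) - ((n + 2 : ℕ) : ℝ) + 1/2 = u + 1 := by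
      push_cast; ring
    have n0 : 0 ≠ n + 3 := by omega
    have n1 : 1 ≠ n + 3 := by omega
    have n2 : n + 3 ≠ 1 := by omega
    have n3 : n + 2 ≠ 1 := by omega
    have n4 : n + 2 ≠ n + 3 := by omega
    have n5 : n + 3 - 1 = n + 2 := rfl
    simp only [cCoef, aCoef, bCoef, n0, n1, n2, n3, n4, n5, e0, e1, e2, if_true, if_false,
      Nat.sub_zero]
    generalize (∫ s in (0:ℝ)..1, (s - 1/2) * (u + 1 + 1 - s) ^ (1 - (3 - 2 * u))) = I at *
    generalize (∫ s in (0:ℝ)..1, (s - 1/2) * (u + 1 - s) ^ (1 - (3 - 2 * u))) = A at *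
    generalize (∫ s in (0:ℝ)..1, (3/2 - s) * (u + 1 - s) ^ (1 - (3 - 2 * u))) = B at *
    generalize (∫ s in (0:ℝ)..(1 - (3 - 2 * u)/2 + 1/2), s ^ (1 - (3 - 2 * u))) = K at *
    have : 0 < 4 * (1 - (3 - 2 * u)/2) * (A + K) -
        (1 + 2 * (1 - (3 - 2 * u)/2)) * (I + B) := by
      nlinarith
    linear_combination mul_pos hT this
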